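/- arXiv:1809.05428 — 2 statements merged into one kernel-verified Lean document; each statement's English description precedes it below -/
import Mathlib

section
/- The ideal I of ℂ[x_0, …, x_n] generated by the n-1 polynomials P_1 = x_0^k + x_1^k + x_2^k and P_{j+1} = λ_j·x_0^k + x_1^k + x_{j+2}^k (j = 1, …, n-2) is a prime ideal. -/
noncomputable section

/-- The polynomials `P₁, …, P_{n-1}` of the generalized Fermat system of type `(k,n)`:
`P₁ = x₀^k + x₁^k + x₂^k` and `P_{j+1} = λ_j·x₀^k + x₁^k + x_{j+2}^k` for `j = 1, …, n-2`
(0-indexed below). -/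
def gfPoly (k n : ℕ) (hn : 3 ≤ n) (lam : Fin (n - 2) → ℂ) :
    Fin (n - 1) → MvPolynomial (Fin (n + 1)) ℂ := fun i =>
  if (i : ℕ) = 0 then
    MvPolynomial.X ⟨0, by omega⟩ ^ k + MvPolynomial.X ⟨1, by omega⟩ ^ k +
      MvPolynomial.X ⟨2, by omega⟩ ^ k
  else
    MvPolynomial.C (lam ⟨(i : ℕ) - 1, by have := i.2; omega⟩) *
        MvPolynomial.X ⟨0, by omega⟩ ^ k +
      MvPolynomial.X ⟨1, by omega⟩ ^ k +
      MvPolynomial.X ⟨(i : ℕ) + 2, by have := i.2; omega⟩ ^ k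

theorem kummer {K L ι : Type*} [Field K] [Field L] [Algebra K L] [IsGalois K L] (k : ℕ)
    (hζ : ∀ z : L, z ^ k = 1 → z ∈ Set.range (algebraMap K L)) (z : ι → L) (hz : ∀ i, z i ≠ 0)
    (hzk : ∀ i, ∃ a : K, z i ^ k = algebraMap K L a)
    (hd : ∀ i j c, z i = algebraMap K L c * z j → i = j) : LinearIndependent K z := by
  have hchar : ∀ i (σ : L ≃ₐ[K] L), (σ (z i) / z i) ∈ Set.range (algebraMap K L) := by
    intro i σ
    apply hζ
    obtain ⟨a, ha⟩ := hzk i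
    have hne := pow_ne_zero k (hz i)
    rw [div_pow, ← map_pow, div_eq_one_iff_eq hne, ha]
    simp
  let χ : ι → (L ≃ₐ[K] L) →* L := fun i =>
    { toFun := fun σ => σ (z i) / z i
      map_one' := by simp [hz i]
      map_mul' := by
        intro σ τ
        obtain ⟨a, ha⟩ := hchar i τ
        have h1 : τ (z i) = algebraMap K L a * z i := by rw [ha]; field_simp [hz i]
        have := hz i
        simp only [AlgEquiv.mul_apply, h1, map_mul, AlgEquiv.commutes]
        field_simp }
  have hinj : Function.Injective χ := by
    intro i j hij
    have : z i / z j ∈ Set.range (algebraMap K L) := by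
      rw [InfiniteGalois.mem_range_algebraMap_iff_fixed]
      intro σ
      have h := DFunLike.congr_fun hij σ
      change σ (z i) / z i = σ (z j) / z j at h
      have h1 := hz i
      have h2 := hz j
      have h3 : σ (z j) ≠ 0 := by simpa using h2
      rw [map_div₀]
      rw [div_eq_div_iff h1 h2] at h
      rw [div_eq_div_iff h3 h2, h, mul_comm]
    obtain ⟨c, hc⟩ := this
    exact hd i j c (by rw [hc]; field_simp [hz j])
  have hli := (linearIndependent_monoidHom (L ≃ₐ[K] L) L).comp χ hinj
  rw [linearIndependent_iff'] at hli ⊢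
  intro s g hg i hi
  have := hli s (fun i => algebraMap K L (g i) * z i) (by
    ext σ
    have h := congrArg σ hg
    simp only [map_sum, map_zero, Algebra.smul_def, map_mul, AlgEquiv.commutes] at h
    simp only [Finset.sum_apply, Pi.smul_apply, Function.comp, smul_eq_mul, Pi.zero_apply]
    rw [← h]
    apply Finset.sum_congr rfl
    intro j _
    change _ * _ * (σ (z j) / z j) = _
    field_simp [hz j]) i hi
  simpa [hz i] using this

theorem roots_in {K L : Type*} [Field K] [Field L] [Algebra K L] (f : ℂ →+* K) (k : ℕ) (hk : 0 < k)
    (z : L) (hz : z ^ k = 1) : z ∈ Set.range (algebraMap K L) := by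
  have h := Complex.isPrimitiveRoot_exp k hk.ne'
  have h2 := h.map_of_injective (f := (algebraMap K L).comp f) (RingHom.injective _)
  have : NeZero k := ⟨hk.ne'⟩
  obtain ⟨i, -, hi⟩ := h2.eq_pow_of_pow_eq_one hz
  exact ⟨_, by rw [← hi, ← map_pow, RingHom.comp_apply]⟩

open Polynomial in
/-- base polys -/
noncomputable def ff (k : ℕ) (m : ℂ) : ℂ[X][X] := -(C (C m * X ^ k) + X ^ k)

open Polynomial in
theorem ff_ne_zero (k : ℕ) (hk : 2 ≤ k) (m : ℂ) : ff k m ≠ 0 := by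
  intro h
  have := congrArg (fun p => p.coeff k) h
  have hk0 : k ≠ 0 := by omega
  rw [ff] at this
  generalize (C m * X ^ k : ℂ[X]) = b at this
  simp [coeff_C, hk0] at this

open Polynomial in
theorem ff_mult (k : ℕ) (hk : 2 ≤ k) (m : ℂ) (hm : m ≠ 0) : ∃ a : ℂ[X], (ff k m).rootMultiplicity a = 1 ∧
    ∀ m', m' ≠ m → (ff k m').rootMultiplicity a = 0 := by
  obtain ⟨w, hw⟩ := IsAlgClosed.exists_pow_nat_eq (-m) (n := k) (by omega)
  have hw0 : w ≠ 0 := by rintro rfl; rw [zero_pow (by omega)] at hw; simp_all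
  have key : ∀ m', (ff k m').eval (C w * X) = C (m - m') * X ^ k := by
    intro m'
    simp only [ff, eval_neg, eval_add, eval_C, eval_pow, eval_X, mul_pow, ← C_pow, hw]
    simp; ring
  refine ⟨C w * X, ?_, ?_⟩
  · have h0 := ff_ne_zero k hk m
    have h1 : 0 < (ff k m).rootMultiplicity (C w * X) := by
      rw [rootMultiplicity_pos h0, IsRoot, key]; simp
    have h2 : ¬ 1 < (ff k m).rootMultiplicity (C w * X) := by
      rw [one_lt_rootMultiplicity_iff_isRoot h0]
      rintro ⟨-, h⟩
      rw [IsRoot] at h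
      rw [ff] at h
      generalize (C m * X ^ k : ℂ[X]) = b at h
      have hk0 : k ≠ 0 := by omega
      simp [derivative_X_pow, hw0, hk0] at h
    omega
  · intro m' hm'
    apply rootMultiplicity_eq_zero
    rw [IsRoot, key]
    simp [sub_eq_zero, hm'.symm]

open Polynomial in
theorem mult_pow {R : Type*} [CommRing R] [IsDomain R] (a : R) (p : R[X]) (n : ℕ) :
    (p ^ n).rootMultiplicity a = n * p.rootMultiplicity a := by
  classical
  rw [← count_roots, ← count_roots, roots_pow, Multiset.count_nsmul]

open Polynomial in
theorem mult_prod {R J : Type*} [CommRing R] [IsDomain R] (a : R) (s : Finset J) (p : J → R[X])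
    (hp : ∀ i, p i ≠ 0) :
    (∏ i ∈ s, p i).rootMultiplicity a = ∑ i ∈ s, (p i).rootMultiplicity a := by
  classical
  induction s using Finset.induction_on with
  | empty => simp
  | insert i s hi ih =>
    rw [Finset.prod_insert hi, Finset.sum_insert hi, rootMultiplicity_mul, ih]
    exact mul_ne_zero (hp i) (Finset.prod_ne_zero_iff.2 fun j _ => hp j)

open Polynomial in
theorem ff_dist (k m : ℕ) (hk : 2 ≤ k) (mu : Fin m → ℂ) (h0 : ∀ i, mu i ≠ 0)
    (hinj : Function.Injective mu) (α β : Fin m → Fin k) (a b : ℂ[X][X]) (ha : a ≠ 0) (hb : b ≠ 0)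
    (h : b ^ k * ∏ i, ff k (mu i) ^ (α i : ℕ) = a ^ k * ∏ i, ff k (mu i) ^ (β i : ℕ)) :
    α = β := by
  funext j
  obtain ⟨r, hr, hr'⟩ := ff_mult k hk (mu j) (h0 j)
  have hne : ∀ γ : Fin m → Fin k, ∀ i, ff k (mu i) ^ (γ i : ℕ) ≠ 0 :=
    fun γ i => pow_ne_zero _ (ff_ne_zero k hk _)
  have hm : ∀ γ : Fin m → Fin k, ∀ c : ℂ[X][X], c ≠ 0 →
      (c ^ k * ∏ i, ff k (mu i) ^ (γ i : ℕ)).rootMultiplicity r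
        = k * c.rootMultiplicity r + (γ j : ℕ) := by
    intro γ c hc
    rw [rootMultiplicity_mul (mul_ne_zero (pow_ne_zero _ hc)
      (Finset.prod_ne_zero_iff.2 fun i _ => hne γ i)), mult_pow, mult_prod _ _ _ (hne γ)]
    congr 1
    rw [Finset.sum_eq_single j]
    · rw [mult_pow, hr, mul_one]
    · intro i _ hij
      rw [mult_pow, hr' _ (fun h => hij (hinj h)), mul_zero]
    · simp
  have h1 := hm α b hb
  rw [h, hm β a ha] at h1
  have h2 := congrArg (· % k) h1
  simp only [Nat.mul_add_mod, Nat.mod_eq_of_lt (α j).2, Nat.mod_eq_of_lt (β j).2] at h2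
  exact Fin.ext h2.symm

/-- The inclusion of the base ring. -/
noncomputable def inc (m : ℕ) :
    Polynomial (Polynomial ℂ) →+* MvPolynomial (Fin (m + 2)) ℂ :=
  Polynomial.eval₂RingHom (Polynomial.eval₂RingHom MvPolynomial.C (MvPolynomial.X 0))
    (MvPolynomial.X 1)

/-- The generators, uniformly. -/
noncomputable def gen (k m : ℕ) (mu : Fin m → ℂ) (i : Fin m) : MvPolynomial (Fin (m + 2)) ℂ :=
  MvPolynomial.C (mu i) * MvPolynomial.X 0 ^ k + MvPolynomial.X 1 ^ k
    + MvPolynomial.X i.succ.succ ^ k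

theorem inc_ff (k m : ℕ) (c : ℂ) : inc m (ff k c) =
    -(MvPolynomial.C c * MvPolynomial.X 0 ^ k + MvPolynomial.X 1 ^ k) := by
  simp [inc, ff, Polynomial.eval₂_pow]

theorem reduce (k m : ℕ) (hk : 2 ≤ k) (mu : Fin m → ℂ) (p : MvPolynomial (Fin (m + 2)) ℂ) :
    ∃ r : (Fin m → Fin k) → Polynomial (Polynomial ℂ),
      Ideal.Quotient.mk (Ideal.span (Set.range (gen k m mu))) p =
      Ideal.Quotient.mk (Ideal.span (Set.range (gen k m mu)))
        (∑ α, inc m (r α) * ∏ i, MvPolynomial.X i.succ.succ ^ (α i : ℕ)) := by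
  classical
  set q := Ideal.Quotient.mk (Ideal.span (Set.range (gen k m mu))) with hq
  have hX : ∀ i : Fin m, q (MvPolynomial.X i.succ.succ) ^ k = q (inc m (ff k (mu i))) := by
    intro i
    rw [← map_pow, hq, Ideal.Quotient.eq, inc_ff]
    have : gen k m mu i ∈ Ideal.span (Set.range (gen k m mu)) := Ideal.subset_span ⟨i, rfl⟩
    convert this using 1
    rw [gen]; ring
  induction p using MvPolynomial.induction_on' with
  | monomial u a =>
    refine ⟨Pi.single (fun i => ⟨u i.succ.succ % k, Nat.mod_lt _ (by omega)⟩)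
      (Polynomial.C (Polynomial.C a) * Polynomial.C Polynomial.X ^ u 0 * Polynomial.X ^ u 1 *
        ∏ i : Fin m, ff k (mu i) ^ (u i.succ.succ / k)), ?_⟩
    rw [Finset.sum_eq_single (fun i => ⟨u i.succ.succ % k, Nat.mod_lt _ (by omega)⟩)]
    · rw [Pi.single_eq_same, MvPolynomial.monomial_eq, Finsupp.prod_fintype _ _ (by simp),
        Fin.prod_univ_succ, Fin.prod_univ_succ]
      have e1 : inc m (Polynomial.C (Polynomial.C a)) = MvPolynomial.C a := by simp [inc]
      have e2 : inc m (Polynomial.C Polynomial.X) = MvPolynomial.X 0 := by simp [inc]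
      have e3 : inc m Polynomial.X = MvPolynomial.X 1 := by simp [inc]
      have e4 : q (∏ i : Fin m, MvPolynomial.X i.succ.succ ^ u i.succ.succ) =
          (∏ i : Fin m, q (inc m (ff k (mu i))) ^ (u i.succ.succ / k)) *
          ∏ i : Fin m, q (MvPolynomial.X i.succ.succ) ^ (u i.succ.succ % k) := by
        rw [← Finset.prod_mul_distrib, map_prod]
        refine Finset.prod_congr rfl fun i _ => ?_
        rw [← hX, ← pow_mul, ← pow_add, Nat.div_add_mod, map_pow]
      rw [map_mul, map_mul, map_mul, e4]
      simp only [map_mul, map_pow, e1, e2, e3, map_prod, Fin.succ_zero_eq_one]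
      ring
    · intro β _ hβ
      rw [Pi.single_eq_of_ne hβ]; simp
    · simp
  | add p p' h h' =>
    obtain ⟨r, hr⟩ := h
    obtain ⟨r', hr'⟩ := h'
    refine ⟨r + r', ?_⟩
    rw [map_add, hr, hr', ← map_add, ← Finset.sum_add_distrib]
    simp only [Pi.add_apply, map_add, add_mul]

theorem gen_prime (k m : ℕ) (hk : 2 ≤ k) (mu : Fin m → ℂ) (h0 : ∀ i, mu i ≠ 0)
    (hinj : Function.Injective mu) : (Ideal.span (Set.range (gen k m mu))).IsPrime := by
  let R := Polynomial (Polynomial ℂ)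
  let K := FractionRing R
  let L := AlgebraicClosure K
  let g : R →+* L := (algebraMap K L).comp (algebraMap R K)
  have hg : Function.Injective g :=
    (algebraMap K L).injective.comp (IsFractionRing.injective R K)
  have hy : ∀ i, ∃ y : L, y ^ k = g (ff k (mu i)) := fun i =>
    IsAlgClosed.exists_pow_nat_eq _ (by omega)
  choose y hy using hy
  have hy0 : ∀ i, y i ≠ 0 := by
    intro i h
    have := hy i
    rw [h, zero_pow (by omega)] at this
    exact ff_ne_zero k hk (mu i) (hg (by rw [← this, map_zero]))
  let φ : MvPolynomial (Fin (m + 2)) ℂ →+* L :=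
    MvPolynomial.eval₂Hom (g.comp (Polynomial.C.comp Polynomial.C))
      (Fin.cons (g (Polynomial.C Polynomial.X)) (Fin.cons (g Polynomial.X) y))
  have hφX : ∀ i : Fin m, φ (MvPolynomial.X i.succ.succ) = y i := by intro i; simp [φ]
  have hφ : φ.comp (inc m) = g := by
    apply Polynomial.ringHom_ext'
    · apply Polynomial.ringHom_ext'
      · ext x; simp [φ, inc]
      · simp [φ, inc]
    · have : (1 : Fin (m + 2)) = Fin.succ 0 := rfl
      simp only [φ, inc, RingHom.comp_apply, Polynomial.coe_eval₂RingHom, Polynomial.eval₂_X,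
        MvPolynomial.coe_eval₂Hom, MvPolynomial.eval₂_X, this, Fin.cons_succ, Fin.cons_zero]
  have hφ' : ∀ x, φ (inc m x) = g x := fun x => RingHom.congr_fun hφ x
  have hle : Ideal.span (Set.range (gen k m mu)) ≤ RingHom.ker φ := by
    rw [Ideal.span_le]
    rintro _ ⟨i, rfl⟩
    have : gen k m mu i = MvPolynomial.X i.succ.succ ^ k - inc m (ff k (mu i)) := by
      rw [inc_ff, gen]; ring
    rw [SetLike.mem_coe, RingHom.mem_ker, this, map_sub, map_pow, hφX, hφ', hy, sub_self]
  have hli : LinearIndependent K (fun α : Fin m → Fin k => ∏ i, y i ^ (α i : ℕ)) := by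
    have hpow : ∀ α : Fin m → Fin k, (∏ i, y i ^ (α i : ℕ)) ^ k =
        g (∏ i, ff k (mu i) ^ (α i : ℕ)) := by
      intro α
      rw [← Finset.prod_pow, map_prod]
      refine Finset.prod_congr rfl fun i _ => ?_
      rw [map_pow, ← hy, ← pow_mul, ← pow_mul, mul_comm]
    have hz : ∀ α : Fin m → Fin k, ∏ i, y i ^ (α i : ℕ) ≠ 0 := fun α =>
      Finset.prod_ne_zero_iff.2 fun i _ => pow_ne_zero _ (hy0 i)
    apply kummer k
      (roots_in ((algebraMap R K).comp (Polynomial.C.comp Polynomial.C)) k (by omega)) _ hz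
    · intro α
      exact ⟨_, hpow α⟩
    · intro α β c hc
      obtain ⟨a, b, hb, rfl⟩ := IsFractionRing.div_surjective (A := R) c
      have hb0 : b ≠ 0 := nonZeroDivisors.ne_zero hb
      have hgb : g b ≠ 0 := fun h => hb0 (hg (by rw [h, map_zero]))
      have hc' : g b * ∏ i, y i ^ (α i : ℕ) = g a * ∏ i, y i ^ (β i : ℕ) := by
        rw [hc, map_div₀]
        change g b * (g a / g b * _) = _
        rw [← mul_assoc, mul_div_cancel₀ _ hgb]
      have ha0 : a ≠ 0 := by
        rintro rfl
        rw [map_zero, zero_mul] at hc'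
        exact mul_ne_zero hgb (hz α) hc'
      apply ff_dist k m hk mu h0 hinj α β a b ha0 hb0
      apply hg
      rw [map_mul, map_mul, ← hpow, ← hpow, map_pow, map_pow, ← mul_pow, ← mul_pow, hc']
  have hge : RingHom.ker φ ≤ Ideal.span (Set.range (gen k m mu)) := by
    intro p hp
    obtain ⟨r, hr⟩ := reduce k m hk mu p
    have h1 := hle (Ideal.Quotient.eq.1 hr)
    rw [RingHom.mem_ker, map_sub, (RingHom.mem_ker).1 hp, zero_sub, neg_eq_zero, map_sum] at h1
    have h2 : ∀ α, r α = 0 := by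
      intro α
      have h3 := Fintype.linearIndependent_iff.1 hli (fun α => algebraMap R K (r α)) (by
        rw [← h1]
        refine Finset.sum_congr rfl fun α _ => ?_
        rw [Algebra.smul_def, map_mul, hφ', map_prod]
        simp only [map_pow, hφX]
        rfl) α
      exact IsFractionRing.injective R K (by rw [h3, map_zero])
    rw [← Ideal.Quotient.eq_zero_iff_mem, hr]
    simp [h2]
  rw [le_antisymm hle hge]
  exact RingHom.ker_isPrime φ

theorem generalized_fermat_ideal_isPrime (k n : ℕ) (hk : 2 ≤ k) (hn : 3 ≤ n)
    (lam : Fin (n - 2) → ℂ) (hl0 : ∀ j, lam j ≠ 0) (hl1 : ∀ j, lam j ≠ 1)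
    (hinj : Function.Injective lam) :
    (Ideal.span (Set.range (gfPoly k n hn lam))).IsPrime := by
  obtain ⟨m, rfl⟩ : ∃ m, n = m + 1 := ⟨n - 1, by omega⟩
  let mu : Fin m → ℂ := fun i =>
    if h : (i : ℕ) = 0 then 1 else lam ⟨(i : ℕ) - 1, by have := i.2; omega⟩
  have key : gfPoly k (m + 1) hn lam = gen k m mu := by
    funext i
    have e1 : (1 : Fin (m + 2)) = ⟨1, by omega⟩ := rfl
    have e2 : ∀ i : Fin m, i.succ.succ = ⟨(i : ℕ) + 2, by have := i.2; omega⟩ := fun i => rfl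
    by_cases h : (i : ℕ) = 0
    · have h2 : (⟨2, by omega⟩ : Fin (m + 2)) = (i : Fin m).succ.succ := by
        rw [e2]; apply Fin.ext; change 2 = (i : ℕ) + 2; omega
      have h1 : mu i = 1 := dif_pos h
      rw [gen, gfPoly, if_pos h, h1, map_one, one_mul, h2]
      rfl
    · have h1 : mu i = lam ⟨(i : ℕ) - 1, by have := i.2; omega⟩ := dif_neg h
      rw [gen, gfPoly, if_neg h, h1]
      rfl
  rw [key]
  apply gen_prime k m hk mu
  · intro i
    by_cases h : (i : ℕ) = 0
    · simp [mu, h]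
    · simp [mu, h, hl0]
  · intro i j hij
    by_cases h : (i : ℕ) = 0 <;> by_cases h' : (j : ℕ) = 0
    · exact Fin.ext (h.trans h'.symm)
    · simp only [mu, h, h', dite_true, dite_false] at hij
      exact absurd hij.symm (hl1 _)
    · simp only [mu, h, h', dite_true, dite_false] at hij
      exact absurd hij (hl1 _)
    · simp only [mu, h, h', dite_false] at hij
      have := congrArg Fin.val (hinj hij)
      simp only at this
      exact Fin.ext (by omega)
end
end

section
/- Let μ ∈ ℂ with μ ∉ {0, 1, λ_1, …, λ_{n-2}}. Then the set of points [x_0 : … : x_n] of the generalized Fermat curve C^k(λ) ⊂ ℙ^n(ℂ) satisfying x_0 ≠ 0 and x_1^k = −μ·x_0^k has exactly k^n elements. (That is, the regular branched covering ρ : C^k(λ) → ℙ^1, ρ([x_0 : … : x_n]) = −(x_1/x_0)^k, whose deck group is H ≅ (ℤ/kℤ)^n, has fibers of exactly k^n points over every value μ outside the branch value set {∞, 0, 1, λ_1, …, λ_{n-2}}.) -/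
noncomputable section

/-- A solution of the generalized Fermat system of type `(k,n)`:
`x₀^k + x₁^k + x₂^k = 0` and `λ_j·x₀^k + x₁^k + x_{j+2}^k = 0` for `j = 1, …, n-2`
(here `lam` is 0-indexed, so `lam j` is `λ_{j+1}` and the last variable index is `j+3`). -/
def gfSol (k n : ℕ) (hn : 3 ≤ n) (lam : Fin (n - 2) → ℂ) (x : Fin (n + 1) → ℂ) : Prop :=
  x ⟨0, by omega⟩ ^ k + x ⟨1, by omega⟩ ^ k + x ⟨2, by omega⟩ ^ k = 0 ∧
    ∀ j : Fin (n - 2),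
      lam j * x ⟨0, by omega⟩ ^ k + x ⟨1, by omega⟩ ^ k +
        x ⟨(j : ℕ) + 3, by have := j.2; omega⟩ ^ k = 0

/-- The prescribed value of `(x_{i+1}/x_0)^k` on the fiber over `mu`. -/
def gfVal (n : ℕ) (lam : Fin (n - 2) → ℂ) (mu : ℂ) (i : Fin n) : ℂ :=
  if _ : (i : ℕ) = 0 then -mu else if _ : (i : ℕ) = 1 then mu - 1 else
    mu - lam ⟨(i : ℕ) - 2, by have := i.2; omega⟩

theorem gfVal_ne (n : ℕ) (lam : Fin (n - 2) → ℂ) (mu : ℂ) (hmu0 : mu ≠ 0) (hmu1 : mu ≠ 1)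
    (hmul : ∀ j, mu ≠ lam j) (i : Fin n) : gfVal n lam mu i ≠ 0 := by
  unfold gfVal
  split_ifs
  · exact neg_ne_zero.mpr hmu0
  · exact sub_ne_zero.mpr hmu1
  · exact sub_ne_zero.mpr (hmul _)

theorem gf_key (k n : ℕ) (hn : 3 ≤ n) (lam : Fin (n - 2) → ℂ) (mu : ℂ) (x : Fin (n + 1) → ℂ) :
    (gfSol k n hn lam x ∧ x ⟨1, by omega⟩ ^ k = -mu * x ⟨0, by omega⟩ ^ k) ↔
      ∀ i : Fin n, x i.succ ^ k = gfVal n lam mu i * x 0 ^ k := by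
  have h0 : (⟨0, by omega⟩ : Fin (n + 1)) = 0 := rfl
  constructor
  · rintro ⟨⟨h2, h3⟩, h1⟩ ⟨i, hi⟩
    rw [h0] at *
    rcases i with _ | _ | i
    · simpa [gfVal] using h1
    · simp only [gfVal, Fin.succ_mk]
      simp
      linear_combination h2 - h1
    · have := h3 ⟨i, by omega⟩
      rw [h0] at this
      simp only [gfVal, Fin.succ_mk]
      simp
      linear_combination this - h1
  · intro h
    have h1 : x ⟨1, by omega⟩ ^ k = -mu * x 0 ^ k := by
      have e := h ⟨0, by omega⟩
      simp only [gfVal, Fin.succ_mk] at e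
      simpa using e
    have h2 : x ⟨2, by omega⟩ ^ k = (mu - 1) * x 0 ^ k := by
      have e := h ⟨1, by omega⟩
      simp only [gfVal, Fin.succ_mk] at e
      simpa using e
    refine ⟨⟨?_, ?_⟩, h1⟩
    · rw [h0]
      linear_combination h1 + h2
    · intro j
      have h3 : x ⟨(j : ℕ) + 3, by have := j.2; omega⟩ ^ k = (mu - lam j) * x 0 ^ k := by
        have e := h ⟨(j : ℕ) + 2, by have := j.2; omega⟩
        simp only [gfVal, Fin.succ_mk] at e
        simpa using e
      rw [h0]
      linear_combination h1 + h3

theorem gf_cons_ne (n : ℕ) (y : Fin n → ℂ) : (Fin.cons 1 y : Fin (n + 1) → ℂ) ≠ 0 := by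
  intro h
  have := congrFun h 0
  simp at this

theorem gf_mk_inj (n : ℕ) : Function.Injective (fun y : Fin n → ℂ =>
    Projectivization.mk ℂ (Fin.cons 1 y : Fin (n + 1) → ℂ) (gf_cons_ne n y)) := by
  intro y z h
  obtain ⟨a, ha⟩ := (Projectivization.mk_eq_mk_iff' ℂ _ _ _ _).1 h
  have h0 := congrFun ha 0
  simp at h0
  subst h0
  funext i
  have := congrFun ha i.succ
  simpa using this.symm

theorem gf_card (k : ℕ) (hk : 2 ≤ k) (a : ℂ) (ha : a ≠ 0) :
    (Polynomial.nthRoots k a).toFinset.card = k := by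
  have hz := Complex.isPrimitiveRoot_exp k (by omega)
  rw [Multiset.toFinset_card_of_nodup (hz.nthRoots_nodup ha), hz.card_nthRoots,
    if_pos (IsAlgClosed.exists_pow_nat_eq a (by omega))]

theorem generalized_fermat_generic_fiber_count (k n : ℕ) (hk : 2 ≤ k) (hn : 3 ≤ n)
    (lam : Fin (n - 2) → ℂ) (hl0 : ∀ j, lam j ≠ 0) (hl1 : ∀ j, lam j ≠ 1)
    (hinj : Function.Injective lam)
    (mu : ℂ) (hmu0 : mu ≠ 0) (hmu1 : mu ≠ 1) (hmul : ∀ j, mu ≠ lam j) :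
    {p : Projectivization ℂ (Fin (n + 1) → ℂ) |
        ∃ (x : Fin (n + 1) → ℂ) (hx : x ≠ 0), gfSol k n hn lam x ∧
          x ⟨0, by omega⟩ ≠ 0 ∧ x ⟨1, by omega⟩ ^ k = -mu * x ⟨0, by omega⟩ ^ k ∧
          p = Projectivization.mk ℂ x hx}.Finite ∧
      {p : Projectivization ℂ (Fin (n + 1) → ℂ) |
        ∃ (x : Fin (n + 1) → ℂ) (hx : x ≠ 0), gfSol k n hn lam x ∧
          x ⟨0, by omega⟩ ≠ 0 ∧ x ⟨1, by omega⟩ ^ k = -mu * x ⟨0, by omega⟩ ^ k ∧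
          p = Projectivization.mk ℂ x hx}.ncard = k ^ n := by
  have hS : {p : Projectivization ℂ (Fin (n + 1) → ℂ) |
        ∃ (x : Fin (n + 1) → ℂ) (hx : x ≠ 0), gfSol k n hn lam x ∧
          x ⟨0, by omega⟩ ≠ 0 ∧ x ⟨1, by omega⟩ ^ k = -mu * x ⟨0, by omega⟩ ^ k ∧
          p = Projectivization.mk ℂ x hx} =
      Set.image (fun y : Fin n → ℂ =>
        Projectivization.mk ℂ (Fin.cons 1 y : Fin (n + 1) → ℂ) (gf_cons_ne n y))
        (Fintype.piFinset fun i => (Polynomial.nthRoots k (gfVal n lam mu i)).toFinset :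
          Finset (Fin n → ℂ)) := by
    ext p
    simp only [Set.mem_setOf_eq, Set.mem_image, Finset.mem_coe, Fintype.mem_piFinset,
      Multiset.mem_toFinset, Polynomial.mem_nthRoots (show 0 < k by omega)]
    constructor
    · rintro ⟨x, hx, hs, h0, h1, rfl⟩
      have hx0 : x 0 ≠ 0 := h0
      have h := (gf_key k n hn lam mu x).1 ⟨hs, h1⟩
      refine ⟨fun i => x i.succ / x 0, fun i => ?_, ?_⟩
      · rw [div_pow, h i, mul_div_cancel_right₀ _ (pow_ne_zero _ hx0)]
      · rw [Projectivization.mk_eq_mk_iff']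
        refine ⟨(x 0)⁻¹, ?_⟩
        funext i
        refine Fin.cases ?_ (fun i => ?_) i
        · simp [hx0]
        · simp [div_eq_inv_mul]
    · rintro ⟨y, hy, rfl⟩
      have h := (gf_key k n hn lam mu (Fin.cons 1 y)).2 (fun i => by simpa using hy i)
      refine ⟨Fin.cons 1 y, gf_cons_ne n y, h.1, ?_, h.2, rfl⟩
      exact one_ne_zero
  rw [hS]
  refine ⟨(Finset.finite_toSet _).image _, ?_⟩
  rw [Set.ncard_image_of_injective _ (gf_mk_inj n), Set.ncard_coe_finset, Fintype.card_piFinset]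
  simp [gf_card k hk _ (gfVal_ne n lam mu hmu0 hmu1 hmul _)]
end
end
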